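/- Every G-set Γ satisfies at least one of the following: (a) Γ belongs to the triangle of transformations Θ(Γ_n) for some 1 ≤ n ≤ m; (b) Γ = Γ_{yz,l} = {(0,t,0) : 0 ≤ t ≤ r−l−1} ∪ {(0,0,p) : 0 ≤ p ≤ l} for some 0 ≤ l ≤ r−1; (c) Γ = TU^l(Γ_{m+1}) for some l ≥ 0 (an iterated upper transformation of Γ_{m+1}). -/

import Mathlib

open scoped BigOperators Classical

namespace GH

/-- Exponent vectors of monomials `x^m y^n z^p`. -/
abbrev N3 : Type := ℕ × ℕ × ℕ

/-- The lattice `ℤ³`. -/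
abbrev Z3 : Type := ℤ × ℤ × ℤ

/-- Inclusion `ℕ³ → ℤ³`. -/
def toZ (v : N3) : Z3 := ((v.1 : ℤ), (v.2.1 : ℤ), (v.2.2 : ℤ))

/-- The weight map `wt(m,n,p) = m + a·n + (r−a)·p (mod r)` on `ℤ³`. -/
def wtZ (r a : ℕ) (v : Z3) : ZMod r :=
  (v.1 : ZMod r) + (a : ZMod r) * (v.2.1 : ZMod r) + ((r - a : ℕ) : ZMod r) * (v.2.2 : ZMod r)

/-- The weight map on `ℕ³`. -/
def wtN (r a : ℕ) (v : N3) : ZMod r := wtZ r a (toZ v)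

/-- A `G`-set: contains the origin, closed under taking summands, and the weight map
restricted to it is a bijection onto `ℤ/rℤ`. -/
structure IsGSet (r a : ℕ) (Γ : Set N3) : Prop where
  zero_mem : (0, 0, 0) ∈ Γ
  dclosed : ∀ u v : N3, u + v ∈ Γ → u ∈ Γ ∧ v ∈ Γ
  bij : Set.BijOn (wtN r a) Γ Set.univ

/-- `wt_Γ(v)`: the (unique, for a `G`-set) element of `Γ` of the same weight as `v`. -/
noncomputable def wtG (r a : ℕ) (Γ : Set N3) (v : N3) : N3 :=
  if h : ∃ w, w ∈ Γ ∧ wtN r a w = wtN r a v then h.choose else (0, 0, 0)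

/-- `(m,n)` is a y-valley of `Γ`. -/
def IsYValley (Γ : Set N3) (m n : ℕ) : Prop :=
  (m, n, 0) ∈ Γ ∧ (m + 1, n, 0) ∈ Γ ∧ (m, n + 1, 0) ∈ Γ ∧ (m + 1, n + 1, 0) ∉ Γ

/-- `(m,n)` is a z-valley of `Γ`. -/
def IsZValley (Γ : Set N3) (m n : ℕ) : Prop :=
  (m, 0, n) ∈ Γ ∧ (m + 1, 0, n) ∈ Γ ∧ (m, 0, n + 1) ∈ Γ ∧ (m + 1, 0, n + 1) ∉ Γ

/-- A primitive `G`-set: it has a y-valley `(i_y, 0)` and a z-valley `(i_z, 0)`. -/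
def IsPrimG (Γ : Set N3) : Prop := (∃ p : ℕ, IsYValley Γ p 0) ∧ (∃ p : ℕ, IsZValley Γ p 0)

/-- `s_Γ(v) = v − wt_Γ(v) ∈ ℤ³`. -/
noncomputable def sG (r a : ℕ) (Γ : Set N3) (v : N3) : Z3 := toZ v - toZ (wtG r a Γ v)

/-- The submonoid `S(Γ)` of `ℤ³` generated by all `s_Γ(v)`. -/
noncomputable def SMon (r a : ℕ) (Γ : Set N3) : AddSubmonoid Z3 :=
  AddSubmonoid.closure (Set.range (sG r a Γ))

/-- The lattice `M = { u ∈ ℤ³ : wt(u) = 0 }` of `G`-invariant monomials. -/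
def latM (r a : ℕ) : Set Z3 := { u | wtZ r a u = 0 }

/-- The standard pairing of `ℝ³` with `ℤ³`. -/
def dotR (α : ℝ × ℝ × ℝ) (u : Z3) : ℝ :=
  α.1 * (u.1 : ℝ) + α.2.1 * (u.2.1 : ℝ) + α.2.2 * (u.2.2 : ℝ)

/-- The cone `σ(Γ) = { α ∈ ℝ³ : ⟨α, s_Γ(v)⟩ ≥ 0 for all v ∈ ℕ³ }`. -/
noncomputable def sigmaCone (r a : ℕ) (Γ : Set N3) : Set (ℝ × ℝ × ℝ) :=
  { α | ∀ v : N3, 0 ≤ dotR α (sG r a Γ v) }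

/-- `span(u₁,…,u_t)`: all `v ∈ ℕ³` dominated componentwise by some `u_s`. -/
def spanSet (s : Set N3) : Set N3 := { v | ∃ u ∈ s, v ≤ u }

/-- `i(Γ)`: the largest `m` with `(m,0,0) ∈ Γ`. -/
noncomputable def iOf (Γ : Set N3) : ℕ := sSup { m : ℕ | (m, 0, 0) ∈ Γ }

/-- `j(Γ)`: the largest `n` with `(0,n,0) ∈ Γ`. -/
noncomputable def jOf (Γ : Set N3) : ℕ := sSup { n : ℕ | (0, n, 0) ∈ Γ }

/-- `k(Γ)`: the largest `p` with `(0,0,p) ∈ Γ`. -/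
noncomputable def kOf (Γ : Set N3) : ℕ := sSup { p : ℕ | (0, 0, p) ∈ Γ }

/-- `c(w) = max { c : w − c·v ∈ ℕ³ }` (componentwise). -/
noncomputable def cmax (v w : N3) : ℕ := sSup { c : ℕ | c • v ≤ w }

/-- The `G`-igsaw transformation of `Γ` in the direction of `u`:
`T_u(Γ) = { w + c(w)·(u − v) : w ∈ Γ }` where `v = wt_Γ(u)`. -/
noncomputable def jig (r a : ℕ) (Γ : Set N3) (u : N3) : Set N3 :=
  { w' | ∃ w ∈ Γ,
      toZ w' = toZ w + (cmax (wtG r a Γ u) w) • (toZ u - toZ (wtG r a Γ u)) }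

/-- The upper transformation `TU(Γ)`. -/
noncomputable def TU (r a : ℕ) (Γ : Set N3) : Set N3 := jig r a Γ (iOf Γ + 1, 0, 0)

/-- The right transformation `TR(Γ)`. -/
noncomputable def TR (r a : ℕ) (Γ : Set N3) : Set N3 := jig r a Γ (0, jOf Γ + 1, 0)

/-- The left transformation `TL(Γ)`. -/
noncomputable def TL (r a : ℕ) (Γ : Set N3) : Set N3 := jig r a Γ (0, 0, kOf Γ + 1)

/-- The y-valley of `Γ` (chosen by choice; unique for a `G`-set having one). -/
noncomputable def yValley (Γ : Set N3) : ℕ × ℕ :=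
  if h : ∃ p : ℕ × ℕ, IsYValley Γ p.1 p.2 then h.choose else (0, 0)

/-- The z-valley of `Γ` (chosen by choice; unique for a `G`-set having one). -/
noncomputable def zValley (Γ : Set N3) : ℕ × ℕ :=
  if h : ∃ p : ℕ × ℕ, IsZValley Γ p.1 p.2 then h.choose else (0, 0)

/-- The upper right transformation `TUR(Γ)`, in the direction `(i_y+1, j_y+1, 0)`. -/
noncomputable def TUR (r a : ℕ) (Γ : Set N3) : Set N3 :=
  jig r a Γ ((yValley Γ).1 + 1, (yValley Γ).2 + 1, 0)

/-- The upper left transformation `TUL(Γ)`, in the direction `(i_z+1, 0, k_z+1)`. -/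
noncomputable def TUL (r a : ℕ) (Γ : Set N3) : Set N3 :=
  jig r a Γ ((zValley Γ).1 + 1, 0, (zValley Γ).2 + 1)

/-- The bound `min{j, k, j − j_y, k − k_z}` for the triangle of transformations. -/
noncomputable def minBound (Γ : Set N3) : ℕ :=
  min (min (jOf Γ) (kOf Γ)) (min (jOf Γ - (yValley Γ).2) (kOf Γ - (zValley Γ).2))

/-- The triangle of transformations `Θ(Γ)`. -/
noncomputable def Theta (r a : ℕ) (Γ : Set N3) : Set (Set N3) :=
  { Γ' | ∃ p q : ℕ, p + q ≤ minBound Γ ∧ Γ' = (TUR r a)^[p] ((TUL r a)^[q] Γ) }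

/-- The recursion step producing `Γ_{n+1}` from `Γ_n`. -/
noncomputable def nextGamma (r a : ℕ) (Γ : Set N3) : Set N3 :=
  if jOf Γ < kOf Γ then TU r a ((TUR r a)^[jOf Γ] Γ)
  else TU r a ((TUL r a)^[kOf Γ] Γ)

/-- The sequence of primitive `G`-sets; `GammaSeq r a b (n-1)` is `Γ_n`,
starting from `Γ₁ = span((1,0,0),(0,b−1,0),(0,0,r−b−1))`. -/
noncomputable def GammaSeq (r a b : ℕ) : ℕ → Set N3
  | 0 => spanSet {(1, 0, 0), (0, b - 1, 0), (0, 0, r - b - 1)}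
  | n + 1 => nextGamma r a (GammaSeq r a b n)


/-! ### Two-gap states

The points `0, b, …, (A + B - 1) b` cut the cycle `ℤ/rℤ` into arcs of only two lengths exactly for
the pairs `(A, B)` produced by the subtractive Euclidean algorithm. -/

/-- A two-gap configuration: `A` and `B` are the indices of the two neighbours of the origin,
`α` and `β` their distances to it. -/
structure GapState where
  /-- index of the right neighbour -/
  A : ℕ
  /-- index of the left neighbour -/
  B : ℕ
  /-- distance to the right neighbour -/
  α : ℕ
  /-- distance to the left neighbour -/
  β : ℕ

/-- The subtractive Euclidean step. -/
def GapState.step (s : GapState) : GapState :=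
  if s.α < s.β then ⟨s.A, s.A + s.B, s.α, s.β - s.α⟩ else ⟨s.A + s.B, s.B, s.α - s.β, s.β⟩

/-- The arithmetic relations satisfied by the gap states of `b = a⁻¹` modulo `r`. -/
structure GapState.Valid (r a : ℕ) (s : GapState) : Prop where
  A_pos : 1 ≤ s.A
  B_pos : 1 ≤ s.B
  α_pos : 1 ≤ s.α
  β_pos : 1 ≤ s.β
  total : s.α * s.B + s.β * s.A = r
  A_cast : (s.A : ZMod r) = a * s.α
  B_cast : (s.B : ZMod r) = -(a * s.β)

/-- The `L`-shaped monomial set attached to a gap state, with lower heights `p` (in `y`) and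
`q` (in `z`). -/
def GapState.shape (s : GapState) (p q : ℕ) : Set N3 :=
  { v | (v.2.2 = 0 ∧ (v.1 < s.B ∧ v.2.1 + q + 1 ≤ s.α ∨ v.1 < s.A + s.B ∧ v.2.1 ≤ p)) ∨
        (v.2.1 = 0 ∧ (v.1 < s.A ∧ v.2.2 + p + 1 ≤ s.β ∨ v.1 < s.A + s.B ∧ v.2.2 ≤ q)) }

theorem GapState.mem_shape (s : GapState) (p q x y z : ℕ) :
    (x, y, z) ∈ s.shape p q ↔
      (z = 0 ∧ (x < s.B ∧ y + q + 1 ≤ s.α ∨ x < s.A + s.B ∧ y ≤ p)) ∨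
        (y = 0 ∧ (x < s.A ∧ z + p + 1 ≤ s.β ∨ x < s.A + s.B ∧ z ≤ q)) :=
  Iff.rfl

theorem wtN_mk {r a : ℕ} (har : a ≤ r) (x y z : ℕ) :
    wtN r a (x, y, z) = (x : ZMod r) + a * y - a * z := by
  simp only [wtN, wtZ, toZ, Nat.cast_sub har, CharP.cast_eq_zero]
  push_cast
  ring

theorem GapState.Valid.step {r a : ℕ} {s : GapState} (hs : s.Valid r a) (hne : s.α ≠ s.β) :
    s.step.Valid r a := by
  obtain ⟨h1, h2, h3, h4, h5, h6, h7⟩ := hs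
  unfold GapState.step
  split_ifs with h
  · obtain ⟨d, hd⟩ := Nat.exists_eq_add_of_lt h
    refine ⟨h1, by simp; omega, h3, by simp; omega, ?_, h6, ?_⟩
    · have : s.β - s.α = d + 1 := by omega
      simp only [this]
      rw [← h5, hd]; ring
    · simp only [Nat.cast_sub h.le, Nat.cast_add, h6, h7]; ring
  · have h : s.β < s.α := by omega
    obtain ⟨d, hd⟩ := Nat.exists_eq_add_of_lt h
    refine ⟨by simp; omega, h2, by simp; omega, h4, ?_, ?_, h7⟩
    · have : s.α - s.β = d + 1 := by omega
      simp only [this]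
      rw [← h5, hd]; ring
    · simp only [Nat.cast_sub h.le, Nat.cast_add, h6, h7]; ring

theorem GapState.Valid.eq_one_of_eq {r a : ℕ} {s : GapState} (hs : s.Valid r a)
    (h : s.α = s.β) : s.α = 1 ∧ s.A + s.B = r := by
  obtain ⟨h1, h2, h3, h4, h5, h6, h7⟩ := hs
  have hdvd : r ∣ s.A + s.B := by
    rw [← ZMod.natCast_eq_zero_iff]
    push_cast
    rw [h6, h7, h]; ring
  have hr : s.α * (s.A + s.B) = r := by rw [← h5, ← h]; ring
  have hle : r ≤ s.A + s.B := Nat.le_of_dvd (by omega) hdvd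
  have hge : s.A + s.B ≤ r := by rw [← hr]; exact Nat.le_mul_of_pos_left _ h3
  refine ⟨?_, by omega⟩
  have : s.α * (s.A + s.B) = 1 * (s.A + s.B) := by omega
  exact Nat.eq_of_mul_eq_mul_right (by omega) this

/-! ### `G`-igsaw transformations -/

theorem toZ_injective : Function.Injective toZ := by
  rintro ⟨x, y, z⟩ ⟨x', y', z'⟩ h
  simpa [toZ] using h

theorem wtG_spec {r a : ℕ} {Γ : Set N3} (hinj : Set.InjOn (wtN r a) Γ) {u v : N3} (hv : v ∈ Γ)
    (huv : wtN r a v = wtN r a u) : wtG r a Γ u = v := by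
  have h : ∃ w, w ∈ Γ ∧ wtN r a w = wtN r a u := ⟨v, hv, huv⟩
  rw [wtG, dif_pos h]
  exact hinj h.choose_spec.1 hv (h.choose_spec.2.trans huv.symm)

theorem cmax_eq_zero {v w : N3} (h : ¬ v ≤ w) : cmax v w = 0 := by
  have : {c : ℕ | c • v ≤ w} = {0} := by
    ext c
    simp only [Set.mem_ofPred_eq, Set.mem_singleton_iff]
    constructor
    · intro hc
      by_contra hc0
      exact h ((le_self_nsmul (zero_le) hc0).trans hc)
    · rintro rfl
      simp
  rw [cmax, this, csSup_singleton]

theorem cmax_eq_one {v w : N3} (h : v ≤ w) (h2 : ¬ 2 • v ≤ w) : cmax v w = 1 := by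
  have : IsGreatest {c : ℕ | c • v ≤ w} 1 := by
    refine ⟨by simpa using h, fun c hc => ?_⟩
    by_contra hc1
    exact h2 ((nsmul_le_nsmul_left (zero_le) (by omega : 2 ≤ c)).trans hc)
  exact this.csSup_eq

theorem mem_jig_iff {r a : ℕ} {Γ : Set N3} (hinj : Set.InjOn (wtN r a) Γ) {u v : N3}
    (hv : v ∈ Γ) (huv : wtN r a v = wtN r a u) (h2 : ∀ w ∈ Γ, ¬ 2 • v ≤ w) (w' : N3) :
    w' ∈ jig r a Γ u ↔ (w' ∈ Γ ∧ ¬ v ≤ w') ∨ ∃ w ∈ Γ, v ≤ w ∧ w' + v = w + u := by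
  have key : ∀ w : N3, (toZ w' = toZ w + (1 : ℕ) • (toZ u - toZ v)) ↔ w' + v = w + u := by
    intro w
    simp only [toZ, one_smul, Prod.ext_iff, Prod.fst_add, Prod.snd_add, Prod.fst_sub, Prod.snd_sub]
    omega
  simp only [jig, Set.mem_ofPred_eq, wtG_spec hinj hv huv]
  constructor
  · rintro ⟨w, hw, hw'⟩
    by_cases hvw : v ≤ w
    · rw [cmax_eq_one hvw (h2 w hw), key] at hw'
      exact Or.inr ⟨w, hw, hvw, hw'⟩
    · rw [cmax_eq_zero hvw, zero_smul, add_zero] at hw'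
      rw [toZ_injective hw']
      exact Or.inl ⟨hw, hvw⟩
  · rintro (⟨hw, hvw⟩ | ⟨w, hw, hvw, hw'⟩)
    · exact ⟨w', hw, by rw [cmax_eq_zero hvw, zero_smul, add_zero]⟩
    · exact ⟨w, hw, by rw [cmax_eq_one hvw (h2 w hw), key]; exact hw'⟩

theorem wtZ_add (r a : ℕ) (u v : Z3) : wtZ r a (u + v) = wtZ r a u + wtZ r a v := by
  simp only [wtZ, Prod.fst_add, Prod.snd_add]
  push_cast
  ring

theorem injOn_jig {r a : ℕ} {Γ : Set N3} (hinj : Set.InjOn (wtN r a) Γ) {u v : N3}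
    (hv : v ∈ Γ) (huv : wtN r a v = wtN r a u) (h2 : ∀ w ∈ Γ, ¬ 2 • v ≤ w) :
    Set.InjOn (wtN r a) (jig r a Γ u) := by
  have key : ∀ w' ∈ jig r a Γ u, ∃ w ∈ Γ, wtN r a w = wtN r a w' ∧
      (v ≤ w ∧ w' + v = w + u ∨ ¬ v ≤ w ∧ w' = w) := by
    intro w' hw'
    rcases (mem_jig_iff hinj hv huv h2 w').1 hw' with ⟨hw, hvw⟩ | ⟨w, hw, hvw, e⟩
    · exact ⟨w', hw, rfl, Or.inr ⟨hvw, rfl⟩⟩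
    · refine ⟨w, hw, ?_, Or.inl ⟨hvw, e⟩⟩
      have hadd : ∀ x y : N3, wtN r a (x + y) = wtN r a x + wtN r a y := by
        intro x y
        rw [wtN, wtN, wtN, ← wtZ_add]
        congr 1
      have := congrArg (wtN r a) e
      rw [hadd, hadd, huv] at this
      exact (add_right_cancel this).symm
  intro w₁ h₁ w₂ h₂ h
  obtain ⟨v₁, hv₁, e₁, c₁⟩ := key w₁ h₁
  obtain ⟨v₂, hv₂, e₂, c₂⟩ := key w₂ h₂
  obtain rfl : v₁ = v₂ := hinj hv₁ hv₂ (by rw [e₁, e₂]; exact h)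
  rcases c₁ with ⟨n₁, c₁⟩ | ⟨n₁, c₁⟩ <;> rcases c₂ with ⟨n₂, c₂⟩ | ⟨n₂, c₂⟩
  · exact add_right_cancel (c₁.trans c₂.symm)
  · exact absurd n₁ n₂
  · exact absurd n₂ n₁
  · rw [c₁, c₂]

theorem GapState.yValley_shape {r a : ℕ} {s : GapState} (hs : s.Valid r a) {p q : ℕ}
    (hα : p + q + 2 ≤ s.α) : yValley (s.shape p q) = (s.B - 1, p) := by
  have hA := hs.A_pos
  have hB := hs.B_pos
  have h : ∃ v : ℕ × ℕ, IsYValley (s.shape p q) v.1 v.2 := by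
    refine ⟨(s.B - 1, p), ?_⟩
    simp only [IsYValley, GapState.mem_shape, true_and]
    omega
  rw [yValley, dif_pos h]
  obtain ⟨x, y, z, w⟩ := h.choose_spec
  simp only [GapState.mem_shape, true_and] at x y z w
  rw [Prod.ext_iff]
  simp only
  omega

theorem GapState.zValley_shape {r a : ℕ} {s : GapState} (hs : s.Valid r a) {p q : ℕ}
    (hβ : p + q + 2 ≤ s.β) : zValley (s.shape p q) = (s.A - 1, q) := by
  have hA := hs.A_pos
  have hB := hs.B_pos
  have h : ∃ v : ℕ × ℕ, IsZValley (s.shape p q) v.1 v.2 := by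
    refine ⟨(s.A - 1, q), ?_⟩
    simp only [IsZValley, GapState.mem_shape, true_and]
    omega
  rw [zValley, dif_pos h]
  obtain ⟨x, y, z, w⟩ := h.choose_spec
  simp only [GapState.mem_shape, true_and] at x y z w
  rw [Prod.ext_iff]
  simp only
  omega

theorem TUR_shape {r a : ℕ} (har : a ≤ r) {s : GapState} (hs : s.Valid r a) {p q : ℕ}
    (hinj : Set.InjOn (wtN r a) (s.shape p q)) (hα : p + q + 2 ≤ s.α) (hβ : p + q + 2 ≤ s.β) :
    TUR r a (s.shape p q) = s.shape (p + 1) q ∧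
      Set.InjOn (wtN r a) (s.shape (p + 1) q) := by
  have hA := hs.A_pos
  have hB := hs.B_pos
  have hv : ((0, 0, s.β - 1 - p) : N3) ∈ s.shape p q := by
    rw [GapState.mem_shape]; omega
  have huv : wtN r a (0, 0, s.β - 1 - p) = wtN r a (s.B - 1 + 1, p + 1, 0) := by
    rw [wtN_mk har, wtN_mk har, Nat.sub_add_cancel hB, hs.B_cast, Nat.sub_sub,
      Nat.cast_sub (by omega)]
    push_cast
    ring
  have h2 : ∀ w ∈ s.shape p q, ¬ 2 • ((0, 0, s.β - 1 - p) : N3) ≤ w := by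
    rintro ⟨x, y, z⟩ hw
    rw [GapState.mem_shape] at hw
    simp only [Prod.smul_mk, smul_eq_mul, Prod.mk_le_mk]
    omega
  have hT : TUR r a (s.shape p q) = s.shape (p + 1) q := by
    rw [TUR, GapState.yValley_shape hs hα]
    ext ⟨x, y, z⟩
    rw [mem_jig_iff hinj hv huv h2, GapState.mem_shape, GapState.mem_shape]
    simp only [Prod.exists, GapState.mem_shape, Prod.mk_le_mk, Prod.mk_add_mk, Prod.mk.injEq]
    constructor
    · rintro (h | ⟨x', y', z', h⟩) <;> omega
    · intro h
      by_cases hy : y = p + 1 ∧ s.B ≤ x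
      · exact Or.inr ⟨x - s.B, 0, s.β - 1 - p, by omega⟩
      · left; omega
  refine ⟨hT, ?_⟩
  rw [← hT, TUR, GapState.yValley_shape hs hα]
  exact injOn_jig hinj hv huv h2

theorem TUL_shape {r a : ℕ} (har : a ≤ r) {s : GapState} (hs : s.Valid r a) {p q : ℕ}
    (hinj : Set.InjOn (wtN r a) (s.shape p q)) (hα : p + q + 2 ≤ s.α) (hβ : p + q + 2 ≤ s.β) :
    TUL r a (s.shape p q) = s.shape p (q + 1) ∧
      Set.InjOn (wtN r a) (s.shape p (q + 1)) := by
  have hA := hs.A_pos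
  have hB := hs.B_pos
  have hv : ((0, s.α - 1 - q, 0) : N3) ∈ s.shape p q := by
    rw [GapState.mem_shape]; omega
  have huv : wtN r a (0, s.α - 1 - q, 0) = wtN r a (s.A - 1 + 1, 0, q + 1) := by
    rw [wtN_mk har, wtN_mk har, Nat.sub_add_cancel hA, hs.A_cast, Nat.sub_sub,
      Nat.cast_sub (by omega)]
    push_cast
    ring
  have h2 : ∀ w ∈ s.shape p q, ¬ 2 • ((0, s.α - 1 - q, 0) : N3) ≤ w := by
    rintro ⟨x, y, z⟩ hw
    rw [GapState.mem_shape] at hw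
    simp only [Prod.smul_mk, smul_eq_mul, Prod.mk_le_mk]
    omega
  have hT : TUL r a (s.shape p q) = s.shape p (q + 1) := by
    rw [TUL, GapState.zValley_shape hs hβ]
    ext ⟨x, y, z⟩
    rw [mem_jig_iff hinj hv huv h2, GapState.mem_shape, GapState.mem_shape]
    simp only [Prod.exists, GapState.mem_shape, Prod.mk_le_mk, Prod.mk_add_mk, Prod.mk.injEq]
    constructor
    · rintro (h | ⟨x', y', z', h⟩) <;> omega
    · intro h
      by_cases hy : z = q + 1 ∧ s.A ≤ x
      · exact Or.inr ⟨x - s.A, s.α - 1 - q, 0, by omega⟩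
      · left; omega
  refine ⟨hT, ?_⟩
  rw [← hT, TUL, GapState.zValley_shape hs hβ]
  exact injOn_jig hinj hv huv h2

theorem TUL_iterate_shape {r a : ℕ} (har : a ≤ r) {s : GapState} (hs : s.Valid r a)
    (hinj : Set.InjOn (wtN r a) (s.shape 0 0)) (q : ℕ) (hα : q + 1 ≤ s.α) (hβ : q + 1 ≤ s.β) :
    (TUL r a)^[q] (s.shape 0 0) = s.shape 0 q ∧ Set.InjOn (wtN r a) (s.shape 0 q) := by
  induction q with
  | zero => exact ⟨rfl, hinj⟩
  | succ q ih =>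
    obtain ⟨h1, h2⟩ := ih (by omega) (by omega)
    rw [Function.iterate_succ_apply', h1]
    exact TUL_shape har hs h2 (by omega) (by omega)

theorem TUR_iterate_shape {r a : ℕ} (har : a ≤ r) {s : GapState} (hs : s.Valid r a) {q : ℕ}
    (hinj : Set.InjOn (wtN r a) (s.shape 0 q)) (p : ℕ) (hα : p + q + 1 ≤ s.α)
    (hβ : p + q + 1 ≤ s.β) :
    (TUR r a)^[p] (s.shape 0 q) = s.shape p q ∧ Set.InjOn (wtN r a) (s.shape p q) := by
  induction p with
  | zero => exact ⟨rfl, hinj⟩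
  | succ p ih =>
    obtain ⟨h1, h2⟩ := ih (by omega) (by omega)
    rw [Function.iterate_succ_apply', h1]
    exact TUR_shape har hs h2 (by omega) (by omega)

theorem sSup_eq_of_forall_iff {P : ℕ → Prop} {M : ℕ} (h : ∀ n, P n ↔ n ≤ M) :
    sSup {n | P n} = M := by
  have : {n | P n} = Set.Iic M := Set.ext h
  rw [this, csSup_Iic]

theorem TU_shape_of_lt {r a : ℕ} (har : a ≤ r) {s : GapState} (hs : s.Valid r a)
    (h : s.α < s.β) (hinj : Set.InjOn (wtN r a) (s.shape (s.α - 1) 0)) :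
    TU r a (s.shape (s.α - 1) 0) = s.step.shape 0 0 ∧
      Set.InjOn (wtN r a) (s.step.shape 0 0) := by
  have hA := hs.A_pos
  have hB := hs.B_pos
  have hα := hs.α_pos
  have hi : iOf (s.shape (s.α - 1) 0) + 1 = s.A + s.B := by
    have : iOf (s.shape (s.α - 1) 0) = s.A + s.B - 1 :=
      sSup_eq_of_forall_iff fun n => by rw [GapState.mem_shape]; omega
    omega
  have hv : ((0, 0, s.β - s.α) : N3) ∈ s.shape (s.α - 1) 0 := by
    rw [GapState.mem_shape]; omega
  have huv : wtN r a (0, 0, s.β - s.α) = wtN r a (s.A + s.B, 0, 0) := by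
    rw [wtN_mk har, wtN_mk har, Nat.cast_add, hs.A_cast, hs.B_cast, Nat.cast_sub h.le]
    push_cast
    ring
  have h2 : ∀ w ∈ s.shape (s.α - 1) 0, ¬ 2 • ((0, 0, s.β - s.α) : N3) ≤ w := by
    rintro ⟨x, y, z⟩ hw
    rw [GapState.mem_shape] at hw
    simp only [Prod.smul_mk, smul_eq_mul, Prod.mk_le_mk]
    omega
  have hT : TU r a (s.shape (s.α - 1) 0) = s.step.shape 0 0 := by
    rw [TU, hi, GapState.step, if_pos h]
    ext ⟨x, y, z⟩
    rw [mem_jig_iff hinj hv huv h2, GapState.mem_shape, GapState.mem_shape]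
    simp only [Prod.exists, GapState.mem_shape, Prod.mk_le_mk, Prod.mk_add_mk, Prod.mk.injEq]
    constructor
    · rintro (h | ⟨x', y', z', h⟩) <;> omega
    · intro h
      by_cases hy : s.A + s.B ≤ x
      · exact Or.inr ⟨x - (s.A + s.B), 0, s.β - s.α, by omega⟩
      · left; omega
  refine ⟨hT, ?_⟩
  rw [← hT, TU, hi]
  exact injOn_jig hinj hv huv h2

theorem TU_shape_of_gt {r a : ℕ} (har : a ≤ r) {s : GapState} (hs : s.Valid r a)
    (h : s.β < s.α) (hinj : Set.InjOn (wtN r a) (s.shape 0 (s.β - 1))) :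
    TU r a (s.shape 0 (s.β - 1)) = s.step.shape 0 0 ∧
      Set.InjOn (wtN r a) (s.step.shape 0 0) := by
  have hA := hs.A_pos
  have hB := hs.B_pos
  have hβ := hs.β_pos
  have hi : iOf (s.shape 0 (s.β - 1)) + 1 = s.A + s.B := by
    have : iOf (s.shape 0 (s.β - 1)) = s.A + s.B - 1 :=
      sSup_eq_of_forall_iff fun n => by rw [GapState.mem_shape]; omega
    omega
  have hv : ((0, s.α - s.β, 0) : N3) ∈ s.shape 0 (s.β - 1) := by
    rw [GapState.mem_shape]; omega
  have huv : wtN r a (0, s.α - s.β, 0) = wtN r a (s.A + s.B, 0, 0) := by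
    rw [wtN_mk har, wtN_mk har, Nat.cast_add, hs.A_cast, hs.B_cast, Nat.cast_sub h.le]
    push_cast
    ring
  have h2 : ∀ w ∈ s.shape 0 (s.β - 1), ¬ 2 • ((0, s.α - s.β, 0) : N3) ≤ w := by
    rintro ⟨x, y, z⟩ hw
    rw [GapState.mem_shape] at hw
    simp only [Prod.smul_mk, smul_eq_mul, Prod.mk_le_mk]
    omega
  have hT : TU r a (s.shape 0 (s.β - 1)) = s.step.shape 0 0 := by
    rw [TU, hi, GapState.step, if_neg (by omega)]
    ext ⟨x, y, z⟩
    rw [mem_jig_iff hinj hv huv h2, GapState.mem_shape, GapState.mem_shape]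
    simp only [Prod.exists, GapState.mem_shape, Prod.mk_le_mk, Prod.mk_add_mk, Prod.mk.injEq]
    constructor
    · rintro (h | ⟨x', y', z', h⟩) <;> omega
    · intro h
      by_cases hy : s.A + s.B ≤ x
      · exact Or.inr ⟨x - (s.A + s.B), s.α - s.β, 0, by omega⟩
      · left; omega
  refine ⟨hT, ?_⟩
  rw [← hT, TU, hi]
  exact injOn_jig hinj hv huv h2

/-- If one of the two gaps has length one, the upper transformation performs the Euclidean step. -/
theorem TU_shape_of_eq_one {r a : ℕ} (har : a ≤ r) {s : GapState} (hs : s.Valid r a)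
    (hne : s.α ≠ s.β) (h1 : s.α = 1 ∨ s.β = 1) (hinj : Set.InjOn (wtN r a) (s.shape 0 0)) :
    TU r a (s.shape 0 0) = s.step.shape 0 0 ∧ Set.InjOn (wtN r a) (s.step.shape 0 0) := by
  have hα := hs.α_pos
  have hβ := hs.β_pos
  rcases lt_or_gt_of_ne hne with h | h
  · have e : s.α - 1 = 0 := by omega
    have := TU_shape_of_lt har hs h
    rw [e] at this
    exact this hinj
  · have e : s.β - 1 = 0 := by omega
    have := TU_shape_of_gt har hs h
    rw [e] at this
    exact this hinj

theorem jOf_shape {r a : ℕ} {s : GapState} (hs : s.Valid r a) : jOf (s.shape 0 0) = s.α - 1 :=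
  sSup_eq_of_forall_iff fun n => by
    have := hs.A_pos
    have := hs.B_pos
    have := hs.α_pos
    rw [GapState.mem_shape]
    omega

theorem kOf_shape {r a : ℕ} {s : GapState} (hs : s.Valid r a) : kOf (s.shape 0 0) = s.β - 1 :=
  sSup_eq_of_forall_iff fun n => by
    have := hs.A_pos
    have := hs.B_pos
    have := hs.β_pos
    rw [GapState.mem_shape]
    omega

theorem isPrimG_shape_iff {r a : ℕ} {s : GapState} (hs : s.Valid r a) :
    IsPrimG (s.shape 0 0) ↔ 2 ≤ s.α ∧ 2 ≤ s.β := by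
  have hA := hs.A_pos
  have hB := hs.B_pos
  simp only [IsPrimG, IsYValley, IsZValley, GapState.mem_shape, true_and]
  constructor
  · rintro ⟨⟨x, hx⟩, ⟨x', hx'⟩⟩
    omega
  · intro h
    exact ⟨⟨s.B - 1, by omega⟩, ⟨s.A - 1, by omega⟩⟩

theorem nextGamma_shape {r a : ℕ} (har : a ≤ r) {s : GapState} (hs : s.Valid r a)
    (hne : s.α ≠ s.β) (hinj : Set.InjOn (wtN r a) (s.shape 0 0)) :
    nextGamma r a (s.shape 0 0) = s.step.shape 0 0 ∧
      Set.InjOn (wtN r a) (s.step.shape 0 0) := by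
  have hα := hs.α_pos
  have hβ := hs.β_pos
  rw [nextGamma, jOf_shape hs, kOf_shape hs]
  split_ifs with h
  · obtain ⟨h1, h2⟩ := TUR_iterate_shape har hs hinj (s.α - 1) (by omega) (by omega)
    rw [h1]
    exact TU_shape_of_lt har hs (by omega) h2
  · obtain ⟨h1, h2⟩ := TUL_iterate_shape har hs hinj (s.β - 1) (by omega) (by omega)
    rw [h1]
    exact TU_shape_of_gt har hs (by omega) h2

theorem shape_mem_Theta {r a : ℕ} (har : a ≤ r) {s : GapState} (hs : s.Valid r a)
    (hα : 2 ≤ s.α) (hβ : 2 ≤ s.β) (hinj : Set.InjOn (wtN r a) (s.shape 0 0)) {p q : ℕ}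
    (hpα : p + q + 1 ≤ s.α) (hpβ : p + q + 1 ≤ s.β) :
    s.shape p q ∈ Theta r a (s.shape 0 0) := by
  refine ⟨p, q, ?_, ?_⟩
  · rw [minBound, jOf_shape hs, kOf_shape hs, GapState.yValley_shape hs hα,
      GapState.zValley_shape hs hβ]
    simp only
    omega
  · obtain ⟨h1, h2⟩ := TUL_iterate_shape har hs hinj q (by omega) (by omega)
    rw [h1, (TUR_iterate_shape har hs h2 p hpα hpβ).1]

/-! ### The initial set -/

/-- The gap state of `Γ₁`. -/
def GapState.initial (r b : ℕ) : GapState := ⟨1, 1, b, r - b⟩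

theorem GapState.valid_initial {r a b : ℕ} (hb1 : 1 ≤ b) (hbr : b < r) (hab : a * b ≡ 1 [MOD r]) :
    (GapState.initial r b).Valid r a := by
  have h : (a : ZMod r) * b = 1 := by
    have := (ZMod.natCast_eq_natCast_iff _ _ _).2 hab
    push_cast at this
    exact this
  refine ⟨le_rfl, le_rfl, hb1, ?_, ?_, ?_, ?_⟩ <;>
    simp only [GapState.initial, Nat.cast_sub hbr.le, CharP.cast_eq_zero] <;> push_cast
  · omega
  · omega
  · exact h.symm
  · linear_combination -h

theorem GammaSeq_zero_eq_shape {r b : ℕ} (a : ℕ) (hb1 : 1 ≤ b) (hbr : b < r) :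
    GammaSeq r a b 0 = (GapState.initial r b).shape 0 0 := by
  ext ⟨x, y, z⟩
  rw [GapState.mem_shape]
  simp only [GammaSeq, spanSet, Set.mem_ofPred_eq, Set.mem_insert_iff, Set.mem_singleton_iff,
    exists_eq_or_imp, exists_eq_left, Prod.mk_le_mk, GapState.initial]
  omega

theorem injOn_shape_initial {r a b : ℕ} (har : a ≤ r) (hb1 : 1 ≤ b) (hbr : b < r)
    (hab : a * b ≡ 1 [MOD r]) :
    Set.InjOn (wtN r a) ((GapState.initial r b).shape 0 0) := by
  have h : (a : ZMod r) * b = 1 := by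
    have := (ZMod.natCast_eq_natCast_iff _ _ _).2 hab
    push_cast at this
    exact this
  rintro ⟨x, y, z⟩ hw ⟨x', y', z'⟩ hw' e
  rw [GapState.mem_shape] at hw hw'
  rw [wtN_mk har, wtN_mk har] at e
  simp only [GapState.initial] at hw hw'
  have key : (((x * b + y - z - (x' * b + y' - z') : ℤ)) : ZMod r) = 0 := by
    push_cast
    linear_combination (b : ZMod r) * e - ((y : ZMod r) - z - y' + z') * h
  rw [ZMod.intCast_zmod_eq_zero_iff_dvd] at key
  have hx : x = 0 ∨ x = 1 := by omega
  have hx' : x' = 0 ∨ x' = 1 := by omega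
  simp only [Prod.mk.injEq]
  have habs := Int.eq_zero_of_abs_lt_dvd key
  rcases hx with rfl | rfl <;> rcases hx' with rfl | rfl <;>
    simp only [Nat.cast_zero, Nat.cast_one, zero_mul, one_mul, abs_lt] at habs <;> omega

/-! ### Heights of a `G`-set -/

/-- `Γ` consists of the columns over `x = 0, …, i`, of height `Y x` in the `y`-direction and
`Z x` in the `z`-direction. -/
structure HasHeights (Γ : Set N3) (i : ℕ) (Y Z : ℕ → ℕ) : Prop where
  mem_y : ∀ x y, (x, y, 0) ∈ Γ ↔ x ≤ i ∧ y ≤ Y x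
  mem_z : ∀ x z, (x, 0, z) ∈ Γ ↔ x ≤ i ∧ z ≤ Z x
  planar : ∀ x y z, (x, y, z) ∈ Γ → y = 0 ∨ z = 0
  anti_y : Antitone Y
  anti_z : Antitone Z

theorem exists_height {S : Set ℕ} (hfin : S.Finite) (hd : ∀ m n, m ≤ n → n ∈ S → m ∈ S) :
    ∃ M, (∀ n, n ∈ S ↔ 0 ∈ S ∧ n ≤ M) ∧ (0 ∉ S → M = 0) := by
  by_cases h0 : 0 ∈ S
  · refine ⟨sSup S, fun n => ⟨fun hn => ⟨h0, le_csSup hfin.bddAbove hn⟩, fun hn => ?_⟩,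
      fun h => absurd h0 h⟩
    exact hd _ _ hn.2 (Nat.sSup_mem ⟨0, h0⟩ hfin.bddAbove)
  · exact ⟨0, fun n => ⟨fun hn => absurd (hd 0 n (Nat.zero_le _) hn) h0, fun hn =>
      absurd hn.1 h0⟩, fun _ => rfl⟩

theorem IsGSet.mem_of_le {r a : ℕ} {Γ : Set N3} (hΓ : IsGSet r a Γ) {u v : N3} (huv : u ≤ v)
    (hv : v ∈ Γ) : u ∈ Γ := by
  obtain ⟨w, rfl⟩ := exists_add_of_le huv
  exact (hΓ.dclosed u w hv).1

theorem IsGSet.exists_hasHeights {r a : ℕ} (hr : 0 < r) (har : a ≤ r) {Γ : Set N3}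
    (hΓ : IsGSet r a Γ) : ∃ i Y Z, HasHeights Γ i Y Z := by
  have : NeZero r := ⟨hr.ne'⟩
  have hfin : Γ.Finite := Set.Finite.of_injOn hΓ.bij.mapsTo hΓ.bij.injOn Set.finite_univ
  obtain ⟨i, hi, -⟩ := exists_height (S := {x | ((x, 0, 0) : N3) ∈ Γ})
    (hfin.preimage fun _ _ _ _ h => (Prod.mk.injEq _ _ _ _ ▸ h).1)
    (fun m n hmn hn => hΓ.mem_of_le (by simpa using hmn) hn)
  have hY : ∀ x, _ := fun x => exists_height (S := {y | ((x, y, 0) : N3) ∈ Γ})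
    (hfin.preimage fun _ _ _ _ h => by simpa using h)
    (fun m n hmn hn => hΓ.mem_of_le (by simpa using hmn) hn)
  have hZ : ∀ x, _ := fun x => exists_height (S := {z | ((x, 0, z) : N3) ∈ Γ})
    (hfin.preimage fun _ _ _ _ h => by simpa using h)
    (fun m n hmn hn => hΓ.mem_of_le (by simpa using hmn) hn)
  choose Y hY hY0 using hY
  choose Z hZ hZ0 using hZ
  simp only [Set.mem_ofPred_eq] at hi hY hY0 hZ hZ0
  refine ⟨i, Y, Z, ?_, ?_, ?_, ?_, ?_⟩
  · intro x y
    rw [hY, hi]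
    simp [hΓ.zero_mem]
  · intro x z
    rw [hZ, hi]
    simp [hΓ.zero_mem]
  · intro x y z h
    by_contra hyz
    have h1 : ((0, 1, 1) : N3) ∈ Γ := hΓ.mem_of_le (by simp; omega) h
    have := hΓ.bij.injOn h1 hΓ.zero_mem (by rw [wtN_mk har, wtN_mk har]; simp)
    simp at this
  · intro x x' hxx
    by_cases h : ((x', 0, 0) : N3) ∈ Γ
    · have h1 := (hY x' (Y x')).2 ⟨h, le_rfl⟩
      exact ((hY x (Y x')).1 (hΓ.mem_of_le (by simpa using hxx) h1)).2
    · rw [hY0 x' h]; exact Nat.zero_le _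
  · intro x x' hxx
    by_cases h : ((x', 0, 0) : N3) ∈ Γ
    · have h1 := (hZ x' (Z x')).2 ⟨h, le_rfl⟩
      exact ((hZ x (Z x')).1 (hΓ.mem_of_le (by simpa using hxx) h1)).2
    · rw [hZ0 x' h]; exact Nat.zero_le _

theorem HasHeights.le_sum {r a : ℕ} {Γ : Set N3} (hΓ : IsGSet r a Γ) {i : ℕ}
    {Y Z : ℕ → ℕ} (h : HasHeights Γ i Y Z) :
    r ≤ ∑ x ∈ Finset.range (i + 1), (1 + Y x + Z x) := by
  let F : Finset N3 := (Finset.range (i + 1)).biUnion fun x =>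
    (Finset.range (Y x + 1)).image (fun t => ((x, t, 0) : N3)) ∪
      (Finset.range (Z x)).image (fun t => ((x, 0, t + 1) : N3))
  have hF : Γ ⊆ F := by
    rintro ⟨x, y, z⟩ hw
    simp only [F, Finset.coe_biUnion, Set.mem_iUnion, Finset.coe_union, Finset.coe_image,
      Finset.coe_range, Set.mem_union, Set.mem_image, Set.mem_Iio, Prod.mk.injEq, exists_prop]
    rcases Nat.eq_zero_or_pos z with rfl | hz
    · obtain ⟨h1, h2⟩ := (h.mem_y x y).1 hw
      exact ⟨x, by omega, Or.inl ⟨y, by omega, rfl, rfl, rfl⟩⟩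
    · obtain rfl : y = 0 := (h.planar x y z hw).resolve_right hz.ne'
      obtain ⟨h1, h2⟩ := (h.mem_z x z).1 hw
      exact ⟨x, by omega, Or.inr ⟨z - 1, by omega, rfl, rfl, by omega⟩⟩
  have hcard : r = Γ.ncard := by
    rw [← Set.InjOn.ncard_image hΓ.bij.injOn, hΓ.bij.image_eq, Set.ncard_univ, Nat.card_zmod]
  calc r = Γ.ncard := hcard
    _ ≤ F.card := by
      rw [← Set.ncard_coe_finset]
      exact Set.ncard_le_ncard hF F.finite_toSet
    _ ≤ _ := by
      refine Finset.card_biUnion_le.trans (Finset.sum_le_sum fun x _ => ?_)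
      refine (Finset.card_union_le _ _).trans ?_
      refine (add_le_add Finset.card_image_le Finset.card_image_le).trans ?_
      simp only [Finset.card_range]
      omega

theorem HasHeights.add_lt {r a : ℕ} (har : a ≤ r) {Γ : Set N3} (hΓ : IsGSet r a Γ) {i : ℕ}
    {Y Z : ℕ → ℕ} (h : HasHeights Γ i Y Z) {x x' d : ℕ} (hx : x ≤ i) (hx' : x' ≤ i) (hd : 0 < d)
    (hxx : (x' : ZMod r) = x + a * d) : Y x + Z x' < d := by
  by_contra hlt
  obtain ⟨y, z, rfl, hy, hz⟩ : ∃ y z, d = y + z ∧ y ≤ Y x ∧ z ≤ Z x' :=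
    ⟨min d (Y x), d - min d (Y x), by omega, by omega, by omega⟩
  have := hΓ.bij.injOn ((h.mem_y x y).2 ⟨hx, hy⟩) ((h.mem_z x' z).2 ⟨hx', hz⟩) (by
    rw [wtN_mk har, wtN_mk har, hxx]
    push_cast
    ring)
  simp only [Prod.mk.injEq] at this
  omega

theorem HasHeights.lt_modulus {r a : ℕ} (hr : 0 < r) (har : a ≤ r) {Γ : Set N3}
    (hΓ : IsGSet r a Γ) {i : ℕ} {Y Z : ℕ → ℕ} (h : HasHeights Γ i Y Z) : i < r := by
  by_contra hlt
  have := hΓ.bij.injOn ((h.mem_y r 0).2 ⟨by omega, Nat.zero_le _⟩) hΓ.zero_mem (by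
    rw [wtN_mk har, wtN_mk har]
    simp)
  simp only [Prod.mk.injEq] at this
  omega

/-! ### Counting -/

theorem sum_heights_eq {A B α β : ℕ} {Y Z : ℕ → ℕ} (h1 : ∀ x < B, Y x + Z (A + x) < α)
    (h2 : ∀ x < A, Y (B + x) + Z x < β)
    (hsum : α * B + β * A ≤ ∑ x ∈ Finset.range (A + B), (1 + Y x + Z x)) :
    (∀ x < B, Y x + Z (A + x) + 1 = α) ∧ ∀ x < A, Y (B + x) + Z x + 1 = β := by
  have e : ∑ x ∈ Finset.range (A + B), (1 + Y x + Z x) =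
      ∑ x ∈ Finset.range B, (Y x + Z (A + x) + 1) +
        ∑ x ∈ Finset.range A, (Y (B + x) + Z x + 1) := by
    simp only [Finset.sum_add_distrib, Finset.sum_const, Finset.card_range, smul_eq_mul]
    rw [Finset.sum_range_add Z A B, add_comm A B, Finset.sum_range_add Y B A]
    ring
  have i1 : ∑ x ∈ Finset.range B, (Y x + Z (A + x) + 1) ≤ ∑ x ∈ Finset.range B, α :=
    Finset.sum_le_sum fun x hx => h1 x (Finset.mem_range.1 hx)
  have i2 : ∑ x ∈ Finset.range A, (Y (B + x) + Z x + 1) ≤ ∑ x ∈ Finset.range A, β :=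
    Finset.sum_le_sum fun x hx => h2 x (Finset.mem_range.1 hx)
  have c1 : ∑ x ∈ Finset.range B, α = α * B := by simp [mul_comm]
  have c2 : ∑ x ∈ Finset.range A, β = β * A := by simp [mul_comm]
  have j1 := (Finset.sum_eq_sum_iff_of_le (s := Finset.range B)
    (f := fun x => Y x + Z (A + x) + 1) (g := fun _ => α)
    fun x hx => h1 x (Finset.mem_range.1 hx)).1 (by omega)
  have j2 := (Finset.sum_eq_sum_iff_of_le (s := Finset.range A)
    (f := fun x => Y (B + x) + Z x + 1) (g := fun _ => β)
    fun x hx => h2 x (Finset.mem_range.1 hx)).1 (by omega)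
  exact ⟨fun x hx => j1 x (Finset.mem_range.2 hx), fun x hx => j2 x (Finset.mem_range.2 hx)⟩

theorem sum_heights_lt {B α β e f : ℕ} {Y Z : ℕ → ℕ} (hY : Antitone Y) (hZ : Antitone Z)
    (he : 0 < e) (hf : 0 < f) (hαβ : α < β)
    (h1 : ∀ x < B + e, Y x + Z (e + f + x) < α)
    (h2 : ∀ x < e, Y (B + e + f + x) + Z x < β - α) :
    ∑ x ∈ Finset.range (B + e + f + e), (1 + Y x + Z x) < α * B + β * (e + f) := by
  have hsplit : ∑ x ∈ Finset.range (B + e + f + e), (1 + Y x + Z x) =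
      ∑ x ∈ Finset.range (B + e), (Y x + Z (e + f + x) + 1) +
        ∑ x ∈ Finset.range f, (Y (B + e + x) + Z (e + x) + 1) +
        ∑ x ∈ Finset.range e, (Y (B + e + f + x) + Z x + 1) := by
    simp only [Finset.sum_add_distrib, Finset.sum_const, Finset.card_range, smul_eq_mul]
    rw [Finset.sum_range_add Y (B + e + f) e, Finset.sum_range_add Y (B + e) f,
      show B + e + f + e = e + f + (B + e) by ring, Finset.sum_range_add Z (e + f) (B + e),
      Finset.sum_range_add Z e f]
    ring
  have i1 := Finset.sum_le_card_nsmul (Finset.range (B + e))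
    (fun x => Y x + Z (e + f + x) + 1) α fun x hx => h1 x (Finset.mem_range.1 hx)
  have i2 := Finset.sum_le_card_nsmul (Finset.range f)
    (fun x => Y (B + e + x) + Z (e + x) + 1) (β - 1) fun x _ => by
      have := h1 0 (by omega)
      have := h2 0 he
      have := hY (Nat.zero_le (B + e + x))
      have := hZ (Nat.zero_le (e + x))
      omega
  have i3 := Finset.sum_le_card_nsmul (Finset.range e)
    (fun x => Y (B + e + f + x) + Z x + 1) (β - α) fun x hx => h2 x (Finset.mem_range.1 hx)
  simp only [Finset.card_range, smul_eq_mul] at i1 i2 i3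
  rw [hsplit]
  obtain ⟨d, rfl⟩ := Nat.exists_eq_add_of_lt hαβ
  have s1 : α + d + 1 - 1 = α + d := by omega
  have s2 : α + d + 1 - α = d + 1 := by omega
  rw [s1] at i2
  rw [s2] at i3
  nlinarith

/-! ### Classification -/

theorem HasHeights.eq_shape {r a : ℕ} (har : a ≤ r) {Γ : Set N3}
    (hΓ : IsGSet r a Γ) {i : ℕ} {Y Z : ℕ → ℕ} (h : HasHeights Γ i Y Z) {s : GapState}
    (hs : s.Valid r a) (hi : s.A + s.B = i + 1) :
    ∃ p q, p + q + 1 ≤ s.α ∧ p + q + 1 ≤ s.β ∧ Γ = s.shape p q := by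
  have hA := hs.A_pos
  have hB := hs.B_pos
  obtain ⟨e1, e2⟩ := sum_heights_eq (A := s.A) (B := s.B) (α := s.α) (β := s.β) (Y := Y) (Z := Z)
    (fun x hx => h.add_lt har hΓ (by omega) (by omega) hs.α_pos
      (by push_cast; rw [hs.A_cast]; ring))
    (fun x hx => h.add_lt har hΓ (by omega) (by omega) hs.β_pos
      (by push_cast; rw [hs.B_cast]; ring))
    (by rw [hs.total, hi]; exact h.le_sum hΓ)
  have f1 : ∀ x < s.B, Y x = Y 0 ∧ Z (s.A + x) = Z s.A := by
    intro x hx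
    have g1 := e1 x hx
    have g2 := e1 0 hB
    have g3 := h.anti_y (Nat.zero_le x)
    have g4 := h.anti_z (Nat.le_add_right s.A x)
    simp only [add_zero] at g2
    omega
  have f2 : ∀ x < s.A, Y (s.B + x) = Y s.B ∧ Z x = Z 0 := by
    intro x hx
    have g1 := e2 x hx
    have g2 := e2 0 hA
    have g3 := h.anti_z (Nat.zero_le x)
    have g4 := h.anti_y (Nat.le_add_right s.B x)
    simp only [add_zero] at g2
    omega
  have g1 := e1 0 hB
  have g2 := e2 0 hA
  simp only [add_zero] at g1 g2
  have g3 := h.anti_y (Nat.zero_le s.B)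
  have g4 := h.anti_z (Nat.zero_le s.A)
  have hYv : ∀ x, x < s.B ∧ Y x = Y 0 ∨ s.A + s.B ≤ x ∨ s.B ≤ x ∧ Y x = Y s.B := by
    intro x
    rcases lt_or_ge x s.B with hx | hx
    · exact Or.inl ⟨hx, (f1 x hx).1⟩
    · rcases lt_or_ge x (s.A + s.B) with hx' | hx'
      · have := (f2 (x - s.B) (by omega)).1
        rw [Nat.add_sub_cancel' hx] at this
        exact Or.inr (Or.inr ⟨hx, this⟩)
      · exact Or.inr (Or.inl hx')
  have hZv : ∀ x, x < s.A ∧ Z x = Z 0 ∨ s.A + s.B ≤ x ∨ s.A ≤ x ∧ Z x = Z s.A := by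
    intro x
    rcases lt_or_ge x s.A with hx | hx
    · exact Or.inl ⟨hx, (f2 x hx).2⟩
    · rcases lt_or_ge x (s.A + s.B) with hx' | hx'
      · have := (f1 (x - s.A) (by omega)).2
        rw [Nat.add_sub_cancel' hx] at this
        exact Or.inr (Or.inr ⟨hx, this⟩)
      · exact Or.inr (Or.inl hx')
  refine ⟨Y s.B, Z s.A, by omega, by omega, ?_⟩
  ext ⟨x, y, z⟩
  have hYx := hYv x
  have hZx := hZv x
  rw [GapState.mem_shape]
  by_cases hz : z = 0
  · subst hz
    rw [h.mem_y]
    omega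
  · by_cases hy : y = 0
    · subst hy
      rw [h.mem_z]
      omega
    · have hn : (x, y, z) ∉ Γ := fun hm => by
        have := h.planar x y z hm
        omega
      simp only [hn, hy, hz, false_and, or_self]

theorem HasHeights.add_le_of_lt {r a : ℕ} (har : a ≤ r) {Γ : Set N3}
    (hΓ : IsGSet r a Γ) {i : ℕ} {Y Z : ℕ → ℕ} (h : HasHeights Γ i Y Z) {s : GapState}
    (hs : s.Valid r a) (hne : s.α ≠ s.β) (hi : s.A + s.B < i + 1) :
    s.step.A + s.step.B ≤ i + 1 := by
  have hA := hs.A_pos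
  have hB := hs.B_pos
  have hsum := h.le_sum hΓ
  unfold GapState.step
  by_contra hcon
  split_ifs at hcon with hlt
  · simp only at hcon
    obtain ⟨e, he⟩ : ∃ e, i + 1 = s.A + s.B + e := ⟨i + 1 - (s.A + s.B), by omega⟩
    obtain ⟨f, hf⟩ : ∃ f, s.A = e + f := ⟨s.A - e, by omega⟩
    have := sum_heights_lt (B := s.B) (e := e) (f := f) h.anti_y h.anti_z (by omega) (by omega) hlt
      (fun x hx => h.add_lt har hΓ (by omega) (by omega) hs.α_pos
        (by rw [← hf]; push_cast; rw [hs.A_cast]; ring))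
      (fun x hx => h.add_lt har hΓ (by omega) (by omega) (by omega)
        (by rw [show s.B + e + f + x = s.B + s.A + x by omega, Nat.cast_sub hlt.le]
            push_cast
            rw [hs.A_cast, hs.B_cast]; ring))
    rw [← hf, hs.total, show s.B + e + f + e = i + 1 by omega] at this
    omega
  · simp only at hcon
    have hlt' : s.β < s.α := by omega
    obtain ⟨e, he⟩ : ∃ e, i + 1 = s.A + s.B + e := ⟨i + 1 - (s.A + s.B), by omega⟩
    obtain ⟨f, hf⟩ : ∃ f, s.B = e + f := ⟨s.B - e, by omega⟩
    have := sum_heights_lt (B := s.A) (e := e) (f := f) h.anti_z h.anti_y (by omega) (by omega)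
      hlt'
      (fun x hx => by
        rw [add_comm]
        exact h.add_lt har hΓ (by omega) (by omega) hs.β_pos
          (by rw [← hf]; push_cast; rw [hs.B_cast]; ring))
      (fun x hx => by
        rw [add_comm]
        exact h.add_lt har hΓ (by omega) (by omega) (by omega)
          (by rw [show s.A + e + f + x = s.A + s.B + x by omega, Nat.cast_sub hlt'.le]
              push_cast
              rw [hs.A_cast, hs.B_cast]; ring))
    rw [← hf, add_comm (s.β * s.A), hs.total, show s.A + e + f + e = i + 1 by omega] at this
    have hc : ∑ x ∈ Finset.range (i + 1), (1 + Z x + Y x) =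
        ∑ x ∈ Finset.range (i + 1), (1 + Y x + Z x) :=
      Finset.sum_congr rfl fun x _ => by ring
    omega

theorem HasHeights.exists_iterate_shape {r a : ℕ} (har : a ≤ r) (hr : 0 < r) {Γ : Set N3}
    (hΓ : IsGSet r a Γ) {i : ℕ} {Y Z : ℕ → ℕ} (h : HasHeights Γ i Y Z) (N : ℕ) :
    ∀ s : GapState, s.α + s.β ≤ N → s.Valid r a → s.A + s.B ≤ i + 1 →
      ∃ k p q, (∀ l < k, (GapState.step^[l] s).α ≠ (GapState.step^[l] s).β) ∧
        p + q + 1 ≤ (GapState.step^[k] s).α ∧ p + q + 1 ≤ (GapState.step^[k] s).β ∧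
        Γ = (GapState.step^[k] s).shape p q := by
  induction N with
  | zero =>
    intro s hN hs
    have := hs.α_pos
    omega
  | succ N ih =>
    intro s hN hs hi
    rcases hi.eq_or_lt with hi | hi
    · obtain ⟨p, q, h1⟩ := h.eq_shape har hΓ hs hi
      exact ⟨0, p, q, fun l hl => absurd hl (Nat.not_lt_zero l), h1⟩
    · have hne : s.α ≠ s.β := fun he => by
        have := (hs.eq_one_of_eq he).2
        have := h.lt_modulus hr har hΓ
        omega
      have hα := hs.α_pos
      have hβ := hs.β_pos
      obtain ⟨k, p, q, h1, h2⟩ := ih s.step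
        (by unfold GapState.step; split_ifs <;> simp only <;> omega) (hs.step hne)
        (h.add_le_of_lt har hΓ hs hne hi)
      refine ⟨k + 1, p, q, ?_, h2⟩
      rintro (_ | l) hl
      · exact hne
      · exact h1 l (by omega)

theorem HasHeights.eq_axes {r a : ℕ} (har : a ≤ r) (hr : 0 < r) {Γ : Set N3}
    (hΓ : IsGSet r a Γ) {Y Z : ℕ → ℕ} (h : HasHeights Γ 0 Y Z) :
    ∃ l : ℕ, l ≤ r - 1 ∧
      Γ = {v : N3 | ∃ t : ℕ, t ≤ r - l - 1 ∧ v = (0, t, 0)} ∪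
          {v : N3 | ∃ s : ℕ, s ≤ l ∧ v = (0, 0, s)} := by
  have h1 := h.le_sum hΓ
  have h2 : Y 0 + Z 0 < r := h.add_lt har hΓ le_rfl le_rfl hr (by simp)
  simp only [zero_add, Finset.sum_range_one] at h1
  refine ⟨Z 0, by omega, ?_⟩
  ext ⟨x, y, z⟩
  simp only [Set.mem_union, Set.mem_ofPred_eq, Prod.mk.injEq]
  constructor
  · intro hw
    rcases h.planar x y z hw with rfl | rfl
    · obtain ⟨hx, hz⟩ := (h.mem_z x z).1 hw
      obtain rfl : x = 0 := by omega
      exact Or.inr ⟨z, hz, rfl, rfl, rfl⟩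
    · obtain ⟨hx, hy⟩ := (h.mem_y x y).1 hw
      obtain rfl : x = 0 := by omega
      exact Or.inl ⟨y, by omega, rfl, rfl, rfl⟩
  · rintro (⟨t, ht, rfl, rfl, rfl⟩ | ⟨t, ht, rfl, rfl, rfl⟩)
    · exact (h.mem_y _ _).2 ⟨le_rfl, by omega⟩
    · exact (h.mem_z _ _).2 ⟨le_rfl, ht⟩

/-- As long as the sets stay primitive, `GammaSeq` follows the Euclidean algorithm. -/
theorem GammaSeq_eq_shape {r a b : ℕ} (har : a ≤ r) (hb1 : 1 ≤ b) (hbr : b < r)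
    (hab : a * b ≡ 1 [MOD r]) (n : ℕ) (hprim : ∀ k < n, IsPrimG (GammaSeq r a b k)) :
    GammaSeq r a b n = (GapState.step^[n] (GapState.initial r b)).shape 0 0 ∧
      (GapState.step^[n] (GapState.initial r b)).Valid r a ∧
      Set.InjOn (wtN r a) ((GapState.step^[n] (GapState.initial r b)).shape 0 0) := by
  induction n with
  | zero =>
    exact ⟨GammaSeq_zero_eq_shape a hb1 hbr, GapState.valid_initial hb1 hbr hab,
      injOn_shape_initial har hb1 hbr hab⟩
  | succ n ih =>
    obtain ⟨h1, h2, h3⟩ := ih fun k hk => hprim k (by omega)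
    have hp := hprim n n.lt_succ_self
    rw [h1, isPrimG_shape_iff h2] at hp
    have hne : (GapState.step^[n] (GapState.initial r b)).α ≠
        (GapState.step^[n] (GapState.initial r b)).β := fun he => by
      have := (h2.eq_one_of_eq he).1
      omega
    rw [GammaSeq, h1, Function.iterate_succ_apply']
    exact ⟨(nextGamma_shape har h2 hne h3).1, h2.step hne, (nextGamma_shape har h2 hne h3).2⟩

theorem TU_iterate_shape {r a : ℕ} (har : a ≤ r) {s : GapState} (hs : s.Valid r a)
    (hinj : Set.InjOn (wtN r a) (s.shape 0 0)) (h1 : s.α = 1 ∨ s.β = 1) (n : ℕ)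
    (hne : ∀ l < n, (GapState.step^[l] s).α ≠ (GapState.step^[l] s).β) :
    (TU r a)^[n] (s.shape 0 0) = (GapState.step^[n] s).shape 0 0 ∧
      ((GapState.step^[n] s).α = 1 ∨ (GapState.step^[n] s).β = 1) := by
  induction n generalizing s with
  | zero => exact ⟨rfl, h1⟩
  | succ n ih =>
    have hne0 : s.α ≠ s.β := hne 0 n.succ_pos
    obtain ⟨hT, hI⟩ := TU_shape_of_eq_one har hs hne0 h1 hinj
    rw [Function.iterate_succ_apply, Function.iterate_succ_apply, hT]
    refine ih (hs.step hne0) hI ?_ fun l hl => hne (l + 1) (by omega)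
    have := hs.α_pos
    have := hs.β_pos
    unfold GapState.step
    split_ifs <;> simp only <;> omega

/-- Main Theorem: every `G`-set belongs to the triangle of transformations of some
primitive `Γ_n` (`n ≤ m`), or is some `Γ_{yz,l}`, or is an iterated upper
transformation of `Γ_{m+1}`. Here `GammaSeq r a b (n-1)` is `Γ_n`. -/
theorem stmt19 (r a : ℕ) (hra : Nat.Coprime r a) (ha2 : 2 ≤ a) (halt : a < r - a) (b m : ℕ) (hb1 : 1 ≤ b) (hb2 : b ≤ r - 1)
    (hab : a * b ≡ 1 [MOD r]) (hm : 1 ≤ m)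
    (hprim : ∀ n : ℕ, n < m → IsPrimG (GammaSeq r a b n))
    (hnotprim : ¬ IsPrimG (GammaSeq r a b m)) :
    ∀ Γ : Set N3, IsGSet r a Γ →
      (∃ n : ℕ, n < m ∧ Γ ∈ Theta r a (GammaSeq r a b n)) ∨
      (∃ l : ℕ, l ≤ r - 1 ∧
        Γ = {v : N3 | ∃ t : ℕ, t ≤ r - l - 1 ∧ v = (0, t, 0)} ∪
            {v : N3 | ∃ s : ℕ, s ≤ l ∧ v = (0, 0, s)}) ∨
      (∃ l : ℕ, Γ = (TU r a)^[l] (GammaSeq r a b m)) := by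
  intro Γ hΓ
  have har : a ≤ r := by omega
  have hr : 0 < r := by omega
  have hbr : b < r := by omega
  obtain ⟨i, Y, Z, h⟩ := hΓ.exists_hasHeights hr har
  rcases Nat.eq_zero_or_pos i with rfl | hi
  · exact Or.inr (Or.inl (h.eq_axes har hr hΓ))
  obtain ⟨k, p, q, hne, hpα, hpβ, rfl⟩ := h.exists_iterate_shape har hr hΓ _
    (GapState.initial r b) le_rfl (GapState.valid_initial hb1 hbr hab)
    (by simp only [GapState.initial]; omega)
  rcases lt_or_ge k m with hk | hk
  · obtain ⟨h1, h2, h3⟩ := GammaSeq_eq_shape har hb1 hbr hab k fun l hl => hprim l (by omega)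
    have hp := hprim k hk
    rw [h1, isPrimG_shape_iff h2] at hp
    refine Or.inl ⟨k, hk, ?_⟩
    rw [h1]
    exact shape_mem_Theta har h2 hp.1 hp.2 h3 hpα hpβ
  · obtain ⟨h1, h2, h3⟩ := GammaSeq_eq_shape har hb1 hbr hab m hprim
    rw [h1, isPrimG_shape_iff h2] at hnotprim
    have hα := h2.α_pos
    have hβ := h2.β_pos
    obtain ⟨l, rfl⟩ := Nat.exists_eq_add_of_le' hk
    obtain ⟨h4, h5⟩ := TU_iterate_shape har h2 h3 (by omega) l fun t ht => by
      rw [← Function.iterate_add_apply]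
      exact hne (t + m) (by omega)
    rw [← Function.iterate_add_apply] at h4 h5
    obtain ⟨rfl, rfl⟩ : p = 0 ∧ q = 0 := by omega
    exact Or.inr (Or.inr ⟨l, by rw [h1, h4]⟩)

end GH
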